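/- arXiv:2311.14156 — 2 statements merged into one kernel-verified Lean document; each statement's English description precedes it below -/
import Mathlib

section
/- Let S be a nonempty finite set, E : S → [0,1], β* ∈ ℝ, δ ∈ (0,1), and m ≥ 1. Draw m i.i.d. samples from the Boltzmann distribution p(β*), let p̂ be the empirical distribution, set λ = √(ln(2/δ)/(2m)), and let β̂ ∈ ℝ be any minimizer of β ↦ L_p̂(β) + λ|β|. Then with probability at least 1 − δ over the samples, for every β ∈ ℝ it holds that L_{p(β*)}(β̂) ≤ L_{p(β*)}(β) + (|β|/√m)·√(2 ln(2/δ)), where L_q(β') denotes the cross-entropy of q with p(β'). -/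
open scoped BigOperators

/-- The Boltzmann distribution at inverse temperature `β` for energy `E`. -/
noncomputable def boltz {S : Type*} [Fintype S] (E : S → ℝ) (β : ℝ) (σ : S) : ℝ :=
  Real.exp (-β * E σ) / ∑ σ' : S, Real.exp (-β * E σ')

/-- Cross-entropy `L_q(β)` between a distribution `q` and the Boltzmann distribution `p(β)`. -/
noncomputable def crossEnt {S : Type*} [Fintype S] (q : S → ℝ) (E : S → ℝ) (β : ℝ) : ℝ :=
  -∑ σ : S, q σ * Real.log (boltz E β σ)

/-- Empirical distribution of `m` samples. -/
noncomputable def empirical {S : Type*} [Fintype S] [DecidableEq S] {m : ℕ}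
    (s : Fin m → S) (σ : S) : ℝ :=
  ((Finset.univ.filter (fun i => s i = σ)).card : ℝ) / m

/-- Probability of the event `A` under `m` i.i.d. draws from the distribution `p`. -/
noncomputable def prodProb {S : Type*} [Fintype S] (p : S → ℝ) (m : ℕ)
    (A : Set (Fin m → S)) : ℝ :=
  ∑ s : Fin m → S, A.indicator (fun s => ∏ i, p (s i)) s

open MeasureTheory ProbabilityTheory in
lemma aux_hoeff {S : Type*} [Fintype S] (p : S → ℝ) (hp : ∀ s, 0 ≤ p s) (hs : ∑ s, p s = 1)
    (E : S → ℝ) (hE : ∀ σ, 0 ≤ E σ ∧ E σ ≤ 1) (t : ℝ) :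
    ∑ s, p s * Real.exp (t * (E s - ∑ σ, p σ * E σ)) ≤ Real.exp (t ^ 2 / 8) := by
  letI : MeasurableSpace S := ⊤
  let μ : Measure S := ∑ s, ENNReal.ofReal (p s) • Measure.dirac s
  have hint : ∀ f : S → ℝ, ∫ x, f x ∂μ = ∑ s, p s * f s := by
    intro f
    have hf : ∀ s, Integrable f (ENNReal.ofReal (p s) • Measure.dirac s) := by
      intro s
      exact (integrable_dirac (by simp)).smul_measure ENNReal.ofReal_ne_top
    rw [integral_finsetSum_measure (fun s _ => hf s)]
    refine Finset.sum_congr rfl fun s _ => ?_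
    rw [integral_smul_measure, integral_dirac, ENNReal.toReal_ofReal (hp s), smul_eq_mul]
  haveI : IsProbabilityMeasure μ := by
    constructor
    simp only [μ, Measure.coe_finsetSum, Finset.sum_apply, Measure.smul_apply, measure_univ,
      smul_eq_mul, mul_one]
    rw [← ENNReal.ofReal_sum_of_nonneg (fun s _ => hp s), hs, ENNReal.ofReal_one]
  have h := (hasSubgaussianMGF_of_mem_Icc (μ := μ) (X := E) (a := 0) (b := 1)
    (measurable_from_top.aemeasurable) (Filter.Eventually.of_forall hE)).mgf_le t
  rw [mgf, hint, hint] at h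
  refine h.trans (le_of_eq ?_)
  congr 1
  simp
  ring

lemma boltz_Z_pos {S : Type*} [Fintype S] [Nonempty S] (E : S → ℝ) (β : ℝ) :
    0 < ∑ σ' : S, Real.exp (-β * E σ') :=
  Finset.sum_pos (fun _ _ => Real.exp_pos _) Finset.univ_nonempty

lemma boltz_nonneg {S : Type*} [Fintype S] [Nonempty S] (E : S → ℝ) (β : ℝ) (σ : S) :
    0 ≤ boltz E β σ := div_nonneg (Real.exp_pos _).le (boltz_Z_pos E β).le

lemma boltz_sum {S : Type*} [Fintype S] [Nonempty S] (E : S → ℝ) (β : ℝ) :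
    ∑ σ, boltz E β σ = 1 := by
  unfold boltz
  rw [← Finset.sum_div, div_self (boltz_Z_pos E β).ne']

lemma crossEnt_eq {S : Type*} [Fintype S] [Nonempty S] (q E : S → ℝ) (hq : ∑ σ, q σ = 1)
    (β : ℝ) : crossEnt q E β
      = β * (∑ σ, q σ * E σ) + Real.log (∑ σ' : S, Real.exp (-β * E σ')) := by
  have h : ∀ σ, q σ * Real.log (boltz E β σ)
      = -(β * (q σ * E σ)) - q σ * Real.log (∑ σ' : S, Real.exp (-β * E σ')) := by
    intro σ
    rw [boltz, Real.log_div (Real.exp_pos _).ne' (boltz_Z_pos E β).ne', Real.log_exp]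
    ring
  rw [crossEnt, Finset.sum_congr rfl (fun σ _ => h σ), Finset.sum_sub_distrib, ← Finset.sum_mul,
    hq, Finset.sum_neg_distrib, ← Finset.mul_sum]
  ring

lemma empirical_sum_mul {S : Type*} [Fintype S] [DecidableEq S] {m : ℕ}
    (s : Fin m → S) (f : S → ℝ) :
    ∑ σ, empirical s σ * f σ = (∑ i, f (s i)) / m := by
  have h : ∀ σ, empirical s σ * f σ = (∑ i, if s i = σ then f σ else 0) / m := by
    intro σ
    rw [← Finset.sum_filter, Finset.sum_const, nsmul_eq_mul, empirical]
    ring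
  rw [Finset.sum_congr rfl (fun σ _ => h σ), ← Finset.sum_div, Finset.sum_comm]
  simp

lemma prod_weight_exp {S : Type*} [Fintype S] (p g : S → ℝ) (m : ℕ) :
    ∑ s : Fin m → S, (∏ i, p (s i)) * Real.exp (∑ i, g (s i))
      = (∑ σ, p σ * Real.exp (g σ)) ^ m := by
  classical
  have := Fintype.sum_pow (fun σ => p σ * Real.exp (g σ)) m
  rw [this]
  refine Finset.sum_congr rfl fun s _ => ?_
  rw [Real.exp_sum, Finset.prod_mul_distrib]

theorem regularized_mle_crossentropy_bound
    {S : Type*} [Fintype S] [Nonempty S] [DecidableEq S]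
    (E : S → ℝ) (hE : ∀ σ, 0 ≤ E σ ∧ E σ ≤ 1)
    (βstar δ : ℝ) (hδ : 0 < δ ∧ δ < 1)
    (m : ℕ) (hm : 1 ≤ m)
    (lam : ℝ) (hlam : lam = Real.sqrt (Real.log (2 / δ) / (2 * m)))
    (βhat : (Fin m → S) → ℝ)
    (hβhat : ∀ s : Fin m → S, ∀ β : ℝ,
      crossEnt (empirical s) E (βhat s) + lam * |βhat s| ≤
        crossEnt (empirical s) E β + lam * |β|) :
    1 - δ ≤ prodProb (boltz E βstar) m
      {s | ∀ β : ℝ,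
        crossEnt (boltz E βstar) E (βhat s) ≤
          crossEnt (boltz E βstar) E β +
            |β| / Real.sqrt m * Real.sqrt (2 * Real.log (2 / δ))} := by
  obtain ⟨hδ0, hδ1⟩ := hδ
  have hm0 : (0:ℝ) < m := by exact_mod_cast hm
  have hlog : 0 < Real.log (2 / δ) := Real.log_pos (by rw [lt_div_iff₀ hδ0]; linarith)
  have hlam0 : 0 ≤ lam := hlam ▸ Real.sqrt_nonneg _
  have hlamsq : 2 * m * lam ^ 2 = Real.log (2 / δ) := by
    rw [hlam, Real.sq_sqrt (by positivity)]
    field_simp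
  have h2lam : ∀ β : ℝ, |β| / Real.sqrt m * Real.sqrt (2 * Real.log (2 / δ)) = 2 * lam * |β| := by
    intro β
    have : Real.sqrt (2 * Real.log (2 / δ)) = 2 * lam * Real.sqrt m := by
      rw [Real.sqrt_eq_iff_mul_self_eq (by positivity) (by positivity)]
      have := Real.mul_self_sqrt hm0.le
      rw [← hlamsq]
      linear_combination (-4 * lam ^ 2) * this
    rw [this]
    have := (Real.sqrt_pos.2 hm0).ne'
    field_simp
  set p := boltz E βstar with hp
  have hp0 : ∀ σ, 0 ≤ p σ := boltz_nonneg E βstar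
  have hp1 : ∑ σ, p σ = 1 := boltz_sum E βstar
  set μ := ∑ σ, p σ * E σ with hμ
  have hemp : ∀ s : Fin m → S, ∑ σ, empirical s σ = 1 := by
    intro s
    have := empirical_sum_mul s (fun _ => 1)
    simpa [hm0.ne'] using this
  have hgood : ∀ s : Fin m → S, |(∑ i, E (s i)) / m - μ| ≤ lam → ∀ β : ℝ,
        crossEnt p E (βhat s) ≤ crossEnt p E β +
            |β| / Real.sqrt m * Real.sqrt (2 * Real.log (2 / δ)) := by
    intro s hD β
    rw [h2lam]
    have h := hβhat s β
    rw [crossEnt_eq _ E (hemp s), crossEnt_eq _ E (hemp s), empirical_sum_mul] at h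
    rw [crossEnt_eq _ E hp1, crossEnt_eq _ E hp1, ← hμ]
    set D := (∑ i, E (s i)) / m
    have h1 : ∀ b : ℝ, |b * (D - μ)| ≤ lam * |b| := by
      intro b
      rw [abs_mul, mul_comm]
      exact mul_le_mul_of_nonneg_right hD (abs_nonneg _)
    have h2 := abs_le.1 (h1 β)
    have h3 := abs_le.1 (h1 (βhat s))
    linarith [h2.1, h2.2, h3.1, h3.2]
  -- tail bound
  have htail : ∀ t : ℝ, |t| = 4 * lam →
      ∑ s : Fin m → S, (∏ i, p (s i)) *
        Real.exp (∑ i, (t * (E (s i) - μ) - 4 * lam ^ 2)) ≤ δ / 2 := by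
    intro t ht
    rw [prod_weight_exp p (fun σ => t * (E σ - μ) - 4 * lam ^ 2)]
    have h1 := aux_hoeff p hp0 hp1 E hE t
    have ht2 : t ^ 2 = 16 * lam ^ 2 := by rw [← sq_abs, ht]; ring
    have h2 : ∑ σ, p σ * Real.exp (t * (E σ - μ) - 4 * lam ^ 2) ≤ Real.exp (-(2 * lam ^ 2)) := by
      have : ∀ σ, p σ * Real.exp (t * (E σ - μ) - 4 * lam ^ 2)
          = p σ * Real.exp (t * (E σ - μ)) * Real.exp (-(4 * lam ^ 2)) := by
        intro σ
        rw [sub_eq_add_neg, Real.exp_add]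
        ring
      rw [Finset.sum_congr rfl (fun σ _ => this σ), ← Finset.sum_mul]
      refine (mul_le_mul_of_nonneg_right h1 (Real.exp_pos _).le).trans (le_of_eq ?_)
      rw [← Real.exp_add, ht2]
      congr 1
      ring
    refine (pow_le_pow_left₀ (Finset.sum_nonneg fun σ _ =>
      mul_nonneg (hp0 σ) (Real.exp_pos _).le) h2 m).trans (le_of_eq ?_)
    rw [← Real.exp_nat_mul]
    have : (m:ℝ) * -(2 * lam ^ 2) = - Real.log (2 / δ) := by rw [← hlamsq]; ring
    rw [this, Real.exp_neg, Real.exp_log (by positivity), inv_div]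
  have hA := htail (4 * lam) (abs_of_nonneg (by positivity))
  have hB := htail (-(4 * lam)) (by rw [abs_neg]; exact abs_of_nonneg (by positivity))
  have hw : ∑ s : Fin m → S, ∏ i, p (s i) = 1 := by
    have := Fintype.sum_pow p m
    rw [← this, hp1, one_pow]
  have hexp : ∀ (t : ℝ) (s : Fin m → S), ∑ i, (t * (E (s i) - μ) - 4 * lam ^ 2)
      = m * (t * ((∑ i, E (s i)) / m - μ) - 4 * lam ^ 2) := by
    intro t s
    rw [Finset.sum_sub_distrib, ← Finset.mul_sum, Finset.sum_sub_distrib]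
    simp
    field_simp
  unfold prodProb
  set A : Set (Fin m → S) := {s | ∀ β : ℝ,
        crossEnt p E (βhat s) ≤ crossEnt p E β +
            |β| / Real.sqrt m * Real.sqrt (2 * Real.log (2 / δ))} with hAdef
  have hpt : ∀ s : Fin m → S, ∏ i, p (s i) ≤ A.indicator (fun s => ∏ i, p (s i)) s
      + ((∏ i, p (s i)) * Real.exp (∑ i, ((4 * lam) * (E (s i) - μ) - 4 * lam ^ 2))
      + (∏ i, p (s i)) * Real.exp (∑ i, (-(4 * lam) * (E (s i) - μ) - 4 * lam ^ 2))) := by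
    intro s
    have hw0 : 0 ≤ ∏ i, p (s i) := Finset.prod_nonneg fun i _ => hp0 _
    have e1 := mul_nonneg hw0
      (Real.exp_pos (∑ i, ((4 * lam) * (E (s i) - μ) - 4 * lam ^ 2))).le
    have e2 := mul_nonneg hw0
      (Real.exp_pos (∑ i, (-(4 * lam) * (E (s i) - μ) - 4 * lam ^ 2))).le
    by_cases hs : s ∈ A
    · rw [Set.indicator_of_mem hs]
      linarith
    · rw [Set.indicator_of_notMem hs]
      have hD : lam < |(∑ i, E (s i)) / m - μ| := by
        by_contra hcon
        exact hs (hgood s (not_lt.1 hcon))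
      rcases lt_abs.1 hD with h | h
      · have : 1 ≤ Real.exp (∑ i, ((4 * lam) * (E (s i) - μ) - 4 * lam ^ 2)) := by
          rw [Real.one_le_exp_iff, hexp]
          refine mul_nonneg hm0.le ?_
          nlinarith
        nlinarith
      · have : 1 ≤ Real.exp (∑ i, (-(4 * lam) * (E (s i) - μ) - 4 * lam ^ 2)) := by
          rw [Real.one_le_exp_iff, hexp]
          refine mul_nonneg hm0.le ?_
          nlinarith
        nlinarith
  have hsum := Finset.sum_le_sum fun s (_ : s ∈ Finset.univ) => hpt s
  rw [hw, Finset.sum_add_distrib, Finset.sum_add_distrib] at hsum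
  linarith
end

section
/- Let S be a nonempty finite set, E : S → ℝ, let p̂ be any probability distribution on S, let λ ≥ 0, and let β̂ ∈ ℝ be a minimizer of β ↦ L_p̂(β) + λ|β| over ℝ, where L_p̂(β) = −Σ_σ p̂(σ) log p(β)(σ) is the cross-entropy between p̂ and the Boltzmann distribution p(β). Then the Boltzmann distribution p(β̂) maximizes the Shannon entropy H(q) = −Σ_σ q(σ) log q(σ) among all probability distributions q on S satisfying the feasibility constraint |E_q[E] − E_p̂[E]| ≤ λ; in particular p(β̂) itself satisfies |E_{p(β̂)}[E] − E_p̂[E]| ≤ λ. -/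
open scoped BigOperators

lemma bz_Z_pos {S : Type*} [Fintype S] [Nonempty S] (E : S → ℝ) (β : ℝ) :
    0 < ∑ σ : S, Real.exp (-β * E σ) :=
  Finset.sum_pos (fun _ _ => Real.exp_pos _) Finset.univ_nonempty

lemma bz_pos {S : Type*} [Fintype S] [Nonempty S] (E : S → ℝ) (β : ℝ) (σ : S) :
    0 < boltz E β σ := div_pos (Real.exp_pos _) (bz_Z_pos E β)

lemma bz_sum {S : Type*} [Fintype S] [Nonempty S] (E : S → ℝ) (β : ℝ) :
    ∑ σ : S, boltz E β σ = 1 := by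
  unfold boltz
  rw [← Finset.sum_div, div_self (bz_Z_pos E β).ne']

lemma bz_crossEnt {S : Type*} [Fintype S] [Nonempty S] (E : S → ℝ) (β : ℝ) (q : S → ℝ)
    (h1 : ∑ σ : S, q σ = 1) :
    crossEnt q E β = β * (∑ σ : S, q σ * E σ) + Real.log (∑ σ : S, Real.exp (-β * E σ)) := by
  unfold crossEnt boltz
  have : ∀ σ, q σ * Real.log (Real.exp (-β * E σ) / ∑ σ' : S, Real.exp (-β * E σ'))
      = -(β * (q σ * E σ)) - q σ * Real.log (∑ σ : S, Real.exp (-β * E σ)) := by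
    intro σ
    rw [Real.log_div (Real.exp_pos _).ne' (bz_Z_pos E β).ne', Real.log_exp]
    ring
  simp only [this]
  rw [Finset.sum_sub_distrib, ← Finset.sum_mul, h1, Finset.sum_neg_distrib, ← Finset.mul_sum]
  ring

lemma bz_hasDerivAt {S : Type*} [Fintype S] [Nonempty S] (E : S → ℝ) (β : ℝ) (q : S → ℝ)
    (h1 : ∑ σ : S, q σ = 1) :
    HasDerivAt (crossEnt q E) ((∑ σ : S, q σ * E σ) - ∑ σ : S, boltz E β σ * E σ) β := by
  have hf : crossEnt q E = fun β => β * (∑ σ : S, q σ * E σ)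
      + Real.log (∑ σ : S, Real.exp (-β * E σ)) := by
    funext b; exact bz_crossEnt E b q h1
  rw [hf]
  have hZ : HasDerivAt (fun b : ℝ => ∑ σ : S, Real.exp (-b * E σ))
      (∑ σ : S, Real.exp (-β * E σ) * (-1 * E σ)) β := by
    apply HasDerivAt.fun_sum
    intro σ _
    exact (((hasDerivAt_id β).neg).mul_const (E σ)).exp
  have h := ((hasDerivAt_id β).mul_const (∑ σ : S, q σ * E σ)).add (hZ.log (bz_Z_pos E β).ne')
  refine h.congr_deriv ?_
  rw [Finset.sum_div, one_mul, sub_eq_add_neg, ← Finset.sum_neg_distrib]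
  congr 1
  apply Finset.sum_congr rfl
  intro σ _
  unfold boltz
  ring

lemma bz_one_sided (h : ℝ → ℝ) (a : ℝ) (hd : HasDerivAt h a 0)
    (hm : ∀ t, 0 < t → h 0 ≤ h t) : 0 ≤ a := by
  have ht := hd.tendsto_slope_zero_right
  refine ge_of_tendsto ht ?_
  filter_upwards [self_mem_nhdsWithin] with t ht0
  have ht0 : 0 < t := ht0
  have := hm t ht0
  rw [zero_add, smul_eq_mul]
  exact mul_nonneg (inv_nonneg.2 ht0.le) (sub_nonneg.2 this)

lemma bz_gibbs {S : Type*} [Fintype S] (p q : S → ℝ) (hp : ∀ σ, 0 < p σ) (hq : ∀ σ, 0 ≤ q σ)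
    (hp1 : ∑ σ, p σ = 1) (hq1 : ∑ σ, q σ = 1) :
    (-∑ σ : S, q σ * Real.log (q σ)) ≤ -∑ σ : S, q σ * Real.log (p σ) := by
  have : ∑ σ, (q σ * Real.log (p σ) - q σ * Real.log (q σ)) ≤ ∑ σ, (p σ - q σ) := by
    apply Finset.sum_le_sum
    intro σ _
    rcases (hq σ).eq_or_lt with h | h
    · rw [← h]; simpa using (hp σ).le
    · have h2 := Real.log_le_sub_one_of_pos (div_pos (hp σ) h)
      rw [Real.log_div (hp σ).ne' h.ne'] at h2
      have h3 := mul_le_mul_of_nonneg_left h2 h.le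
      have h4 : q σ * (p σ / q σ - 1) = p σ - q σ := by field_simp
      linarith
  rw [Finset.sum_sub_distrib, Finset.sum_sub_distrib, hp1, hq1] at this
  linarith

theorem regularized_mle_is_constrained_maxent
    {S : Type*} [Fintype S] [Nonempty S] (E : S → ℝ)
    (phat : S → ℝ) (hphat0 : ∀ σ, 0 ≤ phat σ) (hphat1 : (∑ σ : S, phat σ) = 1)
    (lam : ℝ) (hlam : 0 ≤ lam)
    (βhat : ℝ)
    (hmin : ∀ β : ℝ,
      crossEnt phat E βhat + lam * |βhat| ≤ crossEnt phat E β + lam * |β|) :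
    |(∑ σ : S, boltz E βhat σ * E σ) - ∑ σ : S, phat σ * E σ| ≤ lam
    ∧ ∀ q : S → ℝ, (∀ σ, 0 ≤ q σ) → (∑ σ : S, q σ) = 1 →
        |(∑ σ : S, q σ * E σ) - ∑ σ : S, phat σ * E σ| ≤ lam →
        (-∑ σ : S, q σ * Real.log (q σ)) ≤
          -∑ σ : S, boltz E βhat σ * Real.log (boltz E βhat σ) := by
  set m := ∑ σ : S, phat σ * E σ with hm
  set M := ∑ σ : S, boltz E βhat σ * E σ with hM
  have hL : HasDerivAt (crossEnt phat E) (m - M) βhat := bz_hasDerivAt E βhat phat hphat1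
  -- directional derivative along c
  have hdir : ∀ c : ℝ, HasDerivAt (fun t : ℝ => crossEnt phat E (βhat + c * t)) ((m - M) * c) 0 := by
    intro c
    have hin : HasDerivAt (fun t : ℝ => βhat + c * t) c 0 := by
      simpa using ((hasDerivAt_id (0 : ℝ)).const_mul c).const_add βhat
    have hL' : HasDerivAt (crossEnt phat E) (m - M) (βhat + c * 0) := by simpa using hL
    exact HasDerivAt.comp (h₂ := crossEnt phat E) (h := fun t : ℝ => βhat + c * t) (0 : ℝ) hL' hin
  have hlin : ∀ c b : ℝ, HasDerivAt (fun t : ℝ => crossEnt phat E (βhat + c * t) + b * t)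
      ((m - M) * c + b) 0 := by
    intro c b
    have := (hdir c).add ((hasDerivAt_id (0 : ℝ)).const_mul b)
    rw [mul_one] at this
    exact this
  have key : ∀ c : ℝ, 0 ≤ (m - M) * c + lam * |c| := by
    intro c
    refine bz_one_sided _ _ (hlin c (lam * |c|)) ?_
    intro t ht
    have h1 := hmin (βhat + c * t)
    have h2 : |βhat + c * t| ≤ |βhat| + |c| * t := by
      have := abs_add_le βhat (c * t)
      rwa [abs_mul, abs_of_pos ht] at this
    have h3 := mul_le_mul_of_nonneg_left h2 hlam
    simp only [mul_zero, add_zero]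
    nlinarith
  have k1 := key 1
  have k2 := key (-1)
  rw [abs_neg] at k2
  rw [abs_one] at k1 k2
  have hcs : lam * |βhat| ≤ βhat * (M - m) := by
    have hev : ∀ᶠ t : ℝ in nhdsWithin 0 (Set.Ioi 0), t < 1 :=
      nhdsWithin_le_nhds (eventually_lt_nhds one_pos)
    have ht := (hlin (-βhat) (-(lam * |βhat|))).tendsto_slope_zero_right
    have : 0 ≤ (m - M) * (-βhat) + -(lam * |βhat|) := by
      refine ge_of_tendsto ht ?_
      filter_upwards [self_mem_nhdsWithin, hev] with t ht0 ht1
      have ht0 : 0 < t := ht0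
      rw [zero_add, smul_eq_mul]
      refine mul_nonneg (inv_nonneg.2 ht0.le) (sub_nonneg.2 ?_)
      have h1 := hmin (βhat + -βhat * t)
      have h2 : |βhat + -βhat * t| = |βhat| * (1 - t) := by
        rw [show βhat + -βhat * t = βhat * (1 - t) by ring, abs_mul,
          abs_of_pos (sub_pos.2 ht1)]
      rw [h2] at h1
      simp only [mul_zero, add_zero]
      linarith
    linarith
  refine ⟨abs_le.2 ⟨by linarith, by linarith⟩, ?_⟩
  intro q hq0 hq1 hq
  refine (bz_gibbs (boltz E βhat) q (bz_pos E βhat) hq0 (bz_sum E βhat) hq1).trans ?_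
  have e1 := bz_crossEnt E βhat q hq1
  have e2 := bz_crossEnt E βhat (boltz E βhat) (bz_sum E βhat)
  unfold crossEnt at e1 e2
  rw [e1, e2, ← hM]
  have h5 : βhat * ((∑ σ : S, q σ * E σ) - m) ≤ lam * |βhat| := by
    refine (le_abs_self _).trans ?_
    rw [abs_mul, mul_comm]
    exact mul_le_mul_of_nonneg_right hq (abs_nonneg _)
  linarith
end
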